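/- arXiv:1302.0829 — 2 statements merged into one kernel-verified Lean document; each statement's English description precedes it below -/
import Mathlib

section
/- Let K be a compact Hausdorff totally disconnected topological meet-semilattice with least element 0 and jointly continuous meet. Given a, b ∈ K such that a ≰ b, there exists a compact element p ∈ K such that p ≤ a and p ≰ b. -/
/-- An element `p` of a partially ordered set is a *compact element* if for every
subset `A` of which `p` is a least upper bound there exists a finite subset `A₀ ⊆ A`
of which `p` is a least upper bound. -/
def CompactElem {K : Type*} [PartialOrder K] (p : K) : Prop :=
  ∀ A : Set K, IsLUB A p → ∃ A₀ : Finset K, (A₀ : Set K) ⊆ A ∧ IsLUB (A₀ : Set K) p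

/-- In a Hausdorff topological meet-semilattice principal ideals are closed. -/
theorem isClosed_Iic_of_continuousInf {K : Type*} [TopologicalSpace K] [T2Space K]
    [SemilatticeInf K] [ContinuousInf K] (x : K) : IsClosed (Set.Iic x) := by
  have h : Set.Iic x = {y | y ⊓ x = y} := by ext; simp
  rw [h]
  exact isClosed_eq (by fun_prop) continuous_id

/-- In a Hausdorff topological meet-semilattice principal filters are closed. -/
theorem isClosed_Ici_of_continuousInf {K : Type*} [TopologicalSpace K] [T2Space K]
    [SemilatticeInf K] [ContinuousInf K] (x : K) : IsClosed (Set.Ici x) := by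
  have h : Set.Ici x = {y | x ⊓ y = x} := by ext; simp
  rw [h]
  exact isClosed_eq (by fun_prop) continuous_const

/-- An element of a compact topological meet-semilattice whose principal filter is open is
compact. -/
theorem compactElem_of_isOpen_Ici {K : Type*} [TopologicalSpace K] [CompactSpace K] [T2Space K]
    [SemilatticeInf K] [ContinuousInf K] {p : K} (hp : IsOpen (Set.Ici p)) : CompactElem p := by
  intro A hA
  have hdisj : (Set.Ici p)ᶜ ∩ ⋂ x : A, Set.Ici (x : K) = ∅ := by
    refine Set.eq_empty_of_forall_notMem fun y hy => hy.1 (hA.2 fun x hx => ?_)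
    exact Set.mem_iInter.1 hy.2 ⟨x, hx⟩
  obtain ⟨t, ht⟩ := hp.isClosed_compl.isCompact.elim_finite_subfamily_closed _
    (fun x : A => isClosed_Ici_of_continuousInf (x : K)) hdisj
  refine ⟨t.map (Function.Embedding.subtype _), ?_, ?_, ?_⟩
  · intro x hx
    obtain ⟨y, -, rfl⟩ := Finset.mem_map.1 hx
    exact y.2
  · intro x hx
    obtain ⟨y, -, rfl⟩ := Finset.mem_map.1 hx
    exact hA.1 y.2
  · intro y hy
    by_contra hpy
    refine (ht ▸ (⟨hpy, ?_⟩ : y ∈ (Set.Ici p)ᶜ ∩ ⋂ x ∈ t, Set.Ici (x : K)) : y ∈ (∅ : Set K))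
    exact Set.mem_iInter₂.2 fun x hx => hy (Finset.mem_map_of_mem _ hx)

/-- A nonempty compact subsemilattice of a Hausdorff topological meet-semilattice has a least
element. -/
theorem IsCompact.exists_isLeast_of_infClosed {K : Type*} [TopologicalSpace K] [T2Space K]
    [SemilatticeInf K] [ContinuousInf K] {C : Set K} (hC : IsCompact C) (hne : C.Nonempty)
    (hinf : InfClosed C) : ∃ p, IsLeast C p := by
  have : Nonempty C := hne.to_subtype
  have hclosed (x : C) : IsClosed (C ∩ Set.Iic (x : K)) :=
    hC.isClosed.inter (isClosed_Iic_of_continuousInf _)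
  obtain ⟨p, hp⟩ := IsCompact.nonempty_iInter_of_directed_nonempty_isCompact_isClosed
    (fun x : C => C ∩ Set.Iic (x : K))
    (fun x y => ⟨⟨x ⊓ y, hinf x.2 y.2⟩,
      fun z hz => ⟨hz.1, hz.2.trans inf_le_left⟩, fun z hz => ⟨hz.1, hz.2.trans inf_le_right⟩⟩)
    (fun x => ⟨x, x.2, le_rfl⟩) (fun x => hC.of_isClosed_subset (hclosed x) Set.inter_subset_left)
    hclosed
  rw [Set.mem_iInter] at hp
  exact ⟨p, (hp ⟨_, hne.some_mem⟩).1, fun x hx => (hp ⟨x, hx⟩).2⟩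

/-- The elements that every translation sends into `U` exactly when it sends `a` into `U`. -/
def translationClass {K : Type*} [SemilatticeInf K] (U : Set K) (a : K) : Set K :=
  {x | ∀ s, x ⊓ s ∈ U ↔ a ⊓ s ∈ U}

theorem infClosed_translationClass {K : Type*} [SemilatticeInf K] (U : Set K) (a : K) :
    InfClosed (translationClass U a) := by
  intro x hx y hy s
  rw [inf_assoc, hx, inf_left_comm, hy, inf_left_idem]

theorem isClopen_translationClass {K : Type*} [TopologicalSpace K] [CompactSpace K]
    [SemilatticeInf K] [ContinuousInf K] {U : Set K} (hU : IsClopen U) (a : K) :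
    IsClopen (translationClass U a) := by
  have hW : IsClopen {q : K × K | q.1 ⊓ q.2 ∈ U ↔ a ⊓ q.2 ∈ U} := by
    have h₁ : IsClopen {q : K × K | q.1 ⊓ q.2 ∈ U} := hU.preimage continuous_inf
    have h₂ : IsClopen {q : K × K | a ⊓ q.2 ∈ U} :=
      hU.preimage (f := fun q : K × K => a ⊓ q.2) (by fun_prop)
    convert (h₁.inter h₂).union (h₁.compl.inter h₂.compl) using 1
    ext q
    simp only [Set.mem_ofPred_eq, Set.mem_union, Set.mem_inter_iff, Set.mem_compl_iff]
    tauto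
  constructor
  · simp only [translationClass, Set.ofPred_forall]
    exact isClosed_iInter fun s =>
      hW.isClosed.preimage (f := fun x : K => (x, s)) (by fun_prop)
  · have h : (translationClass U a)ᶜ =
        Prod.fst '' {q : K × K | q.1 ⊓ q.2 ∈ U ↔ a ⊓ q.2 ∈ U}ᶜ := by
      ext x
      simp [translationClass]
    rw [← isClosed_compl_iff, h]
    exact isClosedMap_fst_of_compactSpace _ hW.compl.isClosed

/-- In a compact Hausdorff totally disconnected topological meet-semilattice with
least element `0` and jointly continuous meet, if `a ≰ b` then there exists a
compact element `p` with `p ≤ a` and `p ≰ b`. -/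
theorem stmt1 {K : Type*} [TopologicalSpace K] [CompactSpace K] [T2Space K]
    [TotallyDisconnectedSpace K] [SemilatticeInf K] [OrderBot K]
    (hmeet : Continuous fun x : K × K => x.1 ⊓ x.2) (a b : K) (hab : ¬ a ≤ b) :
    ∃ p : K, CompactElem p ∧ p ≤ a ∧ ¬ p ≤ b := by
  have : ContinuousInf K := ⟨hmeet⟩
  obtain ⟨U, hU, haU, hUb⟩ := compact_exists_isClopen_in_isOpen
    (isClosed_Iic_of_continuousInf b).isOpen_compl hab
  have hC := isClopen_translationClass hU a
  obtain ⟨p, hpC, hp⟩ := hC.isClosed.isCompact.exists_isLeast_of_infClosed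
    ⟨a, fun _ => Iff.rfl⟩ (infClosed_translationClass U a)
  refine ⟨p, compactElem_of_isOpen_Ici ?_, hp fun _ => Iff.rfl, fun hpb => ?_⟩
  · have h : Set.Ici p = (fun x => x ⊓ p) ⁻¹' translationClass U a := by
      ext x
      refine ⟨fun hx => ?_, fun hx => (hp hx).trans inf_le_left⟩
      rwa [Set.mem_preimage, inf_eq_right.2 hx]
    rw [h]
    exact hC.isOpen.preimage (by fun_prop)
  · exact hUb ((hpC a).2 (by rwa [inf_idem])) (inf_le_left.trans hpb)
end

section
/- Let K be a compact Hausdorff totally disconnected topological distributive lattice with least element 0 and greatest element 1 whose operations ⊓ and ⊔ are jointly continuous. Then K is a modest semilattice: for every compact element p ∈ K, the set of immediate predecessors of p is finite. -/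
open Filter Topology

/-- A point of a clopen set `U` in a compact topological meet-semilattice with `⊤` has a clopen
neighbourhood inside `U` that is closed under meets. -/
theorem exists_isClopen_infClosed_subset {K : Type*} [TopologicalSpace K] [CompactSpace K]
    [SemilatticeInf K] [OrderTop K] [ContinuousInf K] {U : Set K} (hU : IsClopen U) {p : K}
    (hp : p ∈ U) : ∃ V ⊆ U, IsClopen V ∧ InfClosed V ∧ p ∈ V := by
  have hR : IsClopen {z : K × K | z.2 ⊓ z.1 ∈ U ↔ z.2 ⊓ p ∈ U} := by
    have h₁ : IsClopen {z : K × K | z.2 ⊓ z.1 ∈ U} :=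
      hU.preimage (continuous_snd.inf continuous_fst)
    have h₂ : IsClopen {z : K × K | z.2 ⊓ p ∈ U} :=
      hU.preimage (continuous_snd.inf continuous_const)
    convert (h₁.inter h₂).union (h₁.compl.inter h₂.compl) using 1
    ext z
    simp only [Set.mem_ofPred_eq, Set.mem_union, Set.mem_inter_iff, Set.mem_compl_iff]
    tauto
  refine ⟨{x | ∀ s, s ⊓ x ∈ U ↔ s ⊓ p ∈ U}, fun x hx ↦ ?_, ⟨?_, ?_⟩, ?_, fun s ↦ Iff.rfl⟩
  · simpa [hp] using hx ⊤
  · rw [Set.ofPred_forall]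
    exact isClosed_iInter fun s ↦ hR.isClosed.preimage (by fun_prop : Continuous fun x : K ↦ (x, s))
  · refine isOpen_iff_mem_nhds.2 fun x hx ↦ ?_
    have := isCompact_univ.eventually_forall_of_forall_eventually (x₀ := x)
      (P := fun x s ↦ s ⊓ x ∈ U ↔ s ⊓ p ∈ U) fun s _ ↦ hR.isOpen.mem_nhds (hx s)
    filter_upwards [this] with y hy s using hy s trivial
  · intro x hx y hy s
    rw [← inf_assoc, hy (s ⊓ x), inf_right_comm, hx (s ⊓ p), inf_assoc, inf_idem]

/-- A nonempty compact closed set closed under meets has a least element. -/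
theorem IsCompact.exists_isLeast_of_infClosed_s8 {K : Type*} [TopologicalSpace K] [SemilatticeInf K]
    [ClosedIicTopology K] {V : Set K} (hV : IsCompact V) (hVc : IsClosed V)
    (hinf : InfClosed V) (hne : V.Nonempty) : ∃ v, IsLeast V v := by
  have : Nonempty V := hne.to_subtype
  obtain ⟨v, hv⟩ := IsCompact.nonempty_iInter_of_directed_nonempty_isCompact_isClosed
    (fun x : V ↦ V ∩ Set.Iic (x : K))
    (fun x y ↦ ⟨⟨x ⊓ y, hinf x.2 y.2⟩,
      Set.inter_subset_inter_right _ (Set.Iic_subset_Iic.2 inf_le_left),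
      Set.inter_subset_inter_right _ (Set.Iic_subset_Iic.2 inf_le_right)⟩)
    (fun x ↦ ⟨x, x.2, le_rfl⟩) (fun x ↦ hV.inter_right isClosed_Iic)
    (fun x ↦ hVc.inter isClosed_Iic)
  rw [Set.mem_iInter] at hv
  exact ⟨v, (hv (Classical.arbitrary V)).1, fun x hx ↦ (hv ⟨x, hx⟩).2⟩

/-- In a compact totally disconnected topological meet-semilattice, the principal filter of a
compact element is a neighbourhood of it. -/
theorem CompactElem.Ici_mem_nhds {K : Type*} [TopologicalSpace K] [CompactSpace K] [T2Space K]
    [TotallyDisconnectedSpace K] [SemilatticeInf K] [OrderTop K] [ContinuousInf K]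
    [ClosedIicTopology K] {p : K} (hp : CompactElem p) : Set.Ici p ∈ 𝓝 p := by
  obtain ⟨A, hA, hlub⟩ := hp {v | ∃ V, IsClopen V ∧ p ∈ V ∧ IsLeast V v} <| by
    refine ⟨fun v ⟨V, _, hpV, hv⟩ ↦ hv.2 hpV, fun b hb ↦ ?_⟩
    by_contra hpb
    obtain ⟨U, hU, hpU, hUb⟩ := compact_exists_isClopen_in_isOpen
      (isClosed_Iic (a := b)).isOpen_compl hpb
    obtain ⟨V, hVU, hV, hinf, hpV⟩ := exists_isClopen_infClosed_subset hU hpU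
    obtain ⟨v, hv⟩ := hV.isClosed.isCompact.exists_isLeast_of_infClosed_s8 hV.isClosed hinf ⟨p, hpV⟩
    exact hUb (hVU hv.1) (hb ⟨V, hV, hpV, hv⟩)
  have hnhds : ∀ v ∈ A, Set.Ici v ∈ 𝓝 p := fun v hv ↦ by
    obtain ⟨V, hV, hpV, hleast⟩ := hA hv
    exact mem_of_superset (hV.isOpen.mem_nhds hpV) hleast.2
  filter_upwards [(Finset.iInter_mem_sets A).2 hnhds] with x hx
  exact hlub.2 fun v hv ↦ Set.mem_iInter₂.1 hx v hv

/-- If infinitely many elements had `p` as an upper cover, they would accumulate at `p`. -/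
theorem frequently_covBy_nhds_of_infinite {K : Type*} [TopologicalSpace K] [CompactSpace K]
    [T2Space K] [SemilatticeSup K] [ContinuousSup K] {p : K} (h : {x : K | x ⋖ p}.Infinite) :
    ∃ᶠ x in 𝓝 p, x ⋖ p := by
  have : (cofinite ⊓ 𝓟 {x : K | x ⋖ p}).NeBot := cofinite_inf_principal_neBot_iff.2 h
  let F := Ultrafilter.of (cofinite ⊓ 𝓟 {x : K | x ⋖ p})
  have hF : (F : Filter K) ≤ cofinite ⊓ 𝓟 {x : K | x ⋖ p} := Ultrafilter.of_le _
  have hcov : ∀ᶠ x in (F : Filter K), x ⋖ p := le_principal_iff.1 (hF.trans inf_le_right)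
  have hlim : (F : Filter K) ≤ 𝓝 F.lim := F.le_nhds_lim
  have hsup : ∀ x, x ⋖ p → x ⊔ F.lim = p := fun x hx ↦ by
    refine tendsto_nhds_unique_of_eventuallyEq (f := fun y ↦ x ⊔ y) (l := (F : Filter K))
      (g := fun _ ↦ p) ?_ tendsto_const_nhds ?_
    · exact ((continuous_const.sup continuous_id).tendsto _).mono_left hlim
    · have hne : ∀ᶠ y in (F : Filter K), y ≠ x :=
        (hF.trans inf_le_left) (Set.finite_singleton x).compl_mem_cofinite
      filter_upwards [hcov, hne] with y hy hyx using hx.wcovBy.sup_eq hy.wcovBy hyx.symm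
  have hlim_eq : F.lim = p := by
    refine tendsto_nhds_unique_of_eventuallyEq (f := fun y ↦ y ⊔ F.lim) (l := (F : Filter K))
      (g := fun _ ↦ p) ?_ tendsto_const_nhds (hcov.mono hsup)
    simpa using ((continuous_id.sup (continuous_const (y := F.lim))).tendsto F.lim).mono_left hlim
  exact hcov.frequently.filter_mono (hlim_eq ▸ hlim)

/-- Every compact Hausdorff totally disconnected topological distributive lattice
with `0` and `1` and jointly continuous operations is a *modest semilattice*:
every compact element has only finitely many immediate predecessors. -/
theorem stmt8 {K : Type*} [TopologicalSpace K] [CompactSpace K] [T2Space K]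
    [TotallyDisconnectedSpace K] [DistribLattice K] [BoundedOrder K]
    (hmeet : Continuous fun x : K × K => x.1 ⊓ x.2)
    (hjoin : Continuous fun x : K × K => x.1 ⊔ x.2) :
    ∀ p : K, CompactElem p → {x : K | x ⋖ p}.Finite := by
  intro p hp
  have : ContinuousInf K := ⟨hmeet⟩
  have : ContinuousSup K := ⟨hjoin⟩
  have : ClosedIicTopology K := ⟨fun a ↦ by
    have h := isClosed_eq (continuous_id.inf (continuous_const (y := a))) continuous_id
    simp only [inf_eq_left] at h
    exact h⟩
  by_contra h
  obtain ⟨x, hx, hpx⟩ :=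
    ((frequently_covBy_nhds_of_infinite h).and_eventually hp.Ici_mem_nhds).exists
  exact hx.lt.not_ge hpx
end
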